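/- arXiv:1410.5654 — 3 statements merged into one kernel-verified Lean document; each statement's English description precedes it below -/
import Mathlib

section
/- Let K be an algebraically closed field of characteristic 0 and let I be a homogeneous ideal of K[x,y] with Hilbert function t_I(0)=1, t_I(1)=2, t_I(2)=1, and t_I(k)=0 for k ≥ 3. Then there exists a linear change of variables φ such that φ(I) = (x², y²) + (x,y)³ or φ(I) = (xy, y²) + (x,y)³. -/
open MvPolynomial

noncomputable section

/-- The polynomial ring `K[x,y]`. -/
abbrev Pxy (K : Type*) [Field K] := MvPolynomial (Fin 2) K

/-- An ideal of `K[x,y]` is homogeneous if it contains all homogeneous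
components of each of its elements. -/
def IsHomog {K : Type*} [Field K] (I : Ideal (Pxy K)) : Prop :=
  ∀ f ∈ I, ∀ k : ℕ, homogeneousComponent k f ∈ I

/-- The Hilbert function of an ideal:
`t_I(k) = dim_K (K[x,y]_k / (I ∩ K[x,y]_k))`. -/
def hilb (K : Type*) [Field K] (I : Ideal (Pxy K)) (k : ℕ) : ℕ :=
  Module.finrank K
    (homogeneousSubmodule (Fin 2) K k ⧸
      Submodule.comap (homogeneousSubmodule (Fin 2) K k).subtype (I.restrictScalars K))

/-- A linear change of variables: a `K`-algebra automorphism sending the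
variables to homogeneous polynomials of degree 1. -/
def IsLinChange {K : Type*} [Field K] (φ : Pxy K ≃ₐ[K] Pxy K) : Prop :=
  ∀ i : Fin 2, (φ (X i)).IsHomogeneous 1

/-- `t` is of homogeneous finite type: there are finitely many homogeneous ideals
`J₁, …, Jₘ` such that every homogeneous ideal `I` with Hilbert function `t` is
mapped onto some `Jᵢ` by a linear change of variables. -/
def HomogFiniteType (K : Type*) [Field K] (t : ℕ → ℕ) : Prop :=
  ∃ S : Set (Ideal (Pxy K)), S.Finite ∧ (∀ J ∈ S, IsHomog J) ∧
    ∀ I : Ideal (Pxy K), IsHomog I → (∀ k, hilb K I k = t k) →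
      ∃ φ : Pxy K ≃ₐ[K] Pxy K, IsLinChange φ ∧ Ideal.map φ I ∈ S

section Auxiliary

variable {K : Type*} [Field K]

lemma span_X_pow_le_of_homogeneousSubmodule_le {I : Ideal (Pxy K)} {n : ℕ}
    (h : ∀ f : Pxy K, f.IsHomogeneous n → f ∈ I) :
    Ideal.span {(X 0 : Pxy K), X 1} ^ n ≤ I := by
  have hr : ({X 0, X 1} : Set (Pxy K)) = Set.range X := by
    ext f; simp [Fin.exists_fin_two, eq_comm]
  rw [hr, Ideal.span, Submodule.span_pow, Submodule.span_le]
  intro f hf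
  apply h
  rw [← mem_homogeneousSubmodule, ← homogeneousSubmodule_one_pow,
    homogeneousSubmodule_one_eq_span_X, Submodule.span_pow]
  exact Submodule.subset_span hf

instance (k : ℕ) : Module.Finite K (homogeneousSubmodule (Fin 2) K k) :=
  Module.Finite.iff_fg.mpr (homogeneousSubmodule_fg _ _ k)

lemma mem_of_hilb_eq_zero {I : Ideal (Pxy K)} {k : ℕ} (h : hilb K I k = 0)
    {f : Pxy K} (hf : f.IsHomogeneous k) : f ∈ I := by
  have := Module.finrank_zero_iff.mp h
  rw [Submodule.Quotient.subsingleton_iff] at this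
  have hm : (⟨f, hf⟩ : homogeneousSubmodule (Fin 2) K k) ∈
      Submodule.comap (homogeneousSubmodule (Fin 2) K k).subtype (I.restrictScalars K) := by
    rw [this]; trivial
  exact hm

lemma eq_zero_of_hilb_one_eq_two {I : Ideal (Pxy K)} (h : hilb K I 1 = 2)
    {f : Pxy K} (hf : f.IsHomogeneous 1) (hfI : f ∈ I) : f = 0 := by
  have hle : Module.finrank K (homogeneousSubmodule (Fin 2) K 1) ≤ 2 := by
    rw [homogeneousSubmodule_one_eq_span_X]
    exact (finrank_range_le_card _).trans (by simp)
  have hq := Submodule.finrank_quotient_add_finrank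
    (Submodule.comap (homogeneousSubmodule (Fin 2) K 1).subtype (I.restrictScalars K))
  rw [show Module.finrank K _ = 2 from h] at hq
  have hbot := Submodule.finrank_eq_zero.mp (show Module.finrank K
    (Submodule.comap (homogeneousSubmodule (Fin 2) K 1).subtype (I.restrictScalars K)) = 0
    by omega)
  have hm : (⟨f, hf⟩ : homogeneousSubmodule (Fin 2) K 1) ∈
      Submodule.comap (homogeneousSubmodule (Fin 2) K 1).subtype (I.restrictScalars K) := hfI
  rw [hbot, Submodule.mem_bot] at hm
  exact congrArg Subtype.val hm

lemma exists_functional_of_hilb_eq_one {I : Ideal (Pxy K)} {k : ℕ} (h : hilb K I k = 1) :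
    ∃ L : Pxy K →ₗ[K] K, (∀ f : Pxy K, f.IsHomogeneous k → (L f = 0 ↔ f ∈ I)) ∧
      ∃ f : Pxy K, f.IsHomogeneous k ∧ L f ≠ 0 := by
  set N := Submodule.comap (homogeneousSubmodule (Fin 2) K k).subtype (I.restrictScalars K)
    with hN
  have e : (homogeneousSubmodule (Fin 2) K k ⧸ N) ≃ₗ[K] K :=
    LinearEquiv.ofFinrankEq _ _ (by rw [Module.finrank_self]; exact h)
  let L : Pxy K →ₗ[K] K := e.toLinearMap ∘ₗ N.mkQ ∘ₗ
    (homogeneousComponent k).codRestrict (homogeneousSubmodule (Fin 2) K k)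
      (homogeneousComponent_mem k)
  have hL : ∀ f : homogeneousSubmodule (Fin 2) K k, L f = e (N.mkQ f) := by
    intro f
    simp only [L, LinearMap.comp_apply, LinearEquiv.coe_coe]
    congr 2
    ext1
    simp [homogeneousComponent_of_mem f.2]
  refine ⟨L, fun f hf => ?_, ?_⟩
  · rw [hL ⟨f, hf⟩, LinearEquiv.map_eq_zero_iff, Submodule.mkQ_apply,
      Submodule.Quotient.mk_eq_zero]
    rfl
  · obtain ⟨q, hq⟩ := e.surjective 1
    obtain ⟨f, rfl⟩ := N.mkQ_surjective q
    exact ⟨f, f.2, by rw [hL, hq]; exact one_ne_zero⟩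

lemma map_eq_zero_of_isHomogeneous_two (L : Pxy K →ₗ[K] K) (h00 : L (X 0 * X 0) = 0)
    (h01 : L (X 0 * X 1) = 0) (h11 : L (X 1 * X 1) = 0) {f : Pxy K} (hf : f.IsHomogeneous 2) :
    L f = 0 := by
  suffices homogeneousSubmodule (Fin 2) K 2 ≤ LinearMap.ker L from this hf
  rw [← homogeneousSubmodule_one_pow, homogeneousSubmodule_one_eq_span_X, pow_two,
    Submodule.span_mul_span, Submodule.span_le]
  rintro _ ⟨_, ⟨i, rfl⟩, _, ⟨j, rfl⟩, rfl⟩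
  fin_cases i <;> fin_cases j <;> simp [h00, h01, h11, mul_comm (X 1) (X 0 : Pxy K)]

/-- Every polynomial in two variables is a quadratic polynomial modulo `(x, y) ^ 3`. -/
lemma exists_eq_quadratic_add (g : Pxy K) :
    ∃ a b c d e f : K, ∃ h ∈ Ideal.span {(X 0 : Pxy K), X 1} ^ 3,
      g = C a + (C b * X 0 + C c * X 1) +
        (C d * (X 0 * X 0) + C e * (X 0 * X 1) + C f * (X 1 * X 1)) + h := by
  have hX : ∀ i : Fin 2, (X i : Pxy K) ∈ Ideal.span {(X 0 : Pxy K), X 1} := by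
    intro i
    apply Ideal.subset_span
    fin_cases i <;> simp
  have h3 : ∀ i j k : Fin 2,
      (X i * X j * X k : Pxy K) ∈ Ideal.span {(X 0 : Pxy K), X 1} ^ 3 := by
    intro i j k
    rw [pow_succ, pow_two]
    exact Ideal.mul_mem_mul (Ideal.mul_mem_mul (hX i) (hX j)) (hX k)
  induction g using MvPolynomial.induction_on with
  | C a => exact ⟨a, 0, 0, 0, 0, 0, 0, Ideal.zero_mem _, by simp⟩
  | add p q hp hq =>
    obtain ⟨a, b, c, d, e, f, h, hh, rfl⟩ := hp
    obtain ⟨a', b', c', d', e', f', h', hh', rfl⟩ := hq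
    exact ⟨a + a', b + b', c + c', d + d', e + e', f + f', h + h', Ideal.add_mem _ hh hh',
      by simp only [C_add]; ring⟩
  | mul_X p n hp =>
    obtain ⟨a, b, c, d, e, f, h, hh, rfl⟩ := hp
    have hr : C d * (X 0 * X 0 * X n) + C e * (X 0 * X 1 * X n) + C f * (X 1 * X 1 * X n) +
        h * X n ∈ Ideal.span {(X 0 : Pxy K), X 1} ^ 3 :=
      Ideal.add_mem _ (Ideal.add_mem _ (Ideal.add_mem _ (Ideal.mul_mem_left _ _ (h3 _ _ _))
        (Ideal.mul_mem_left _ _ (h3 _ _ _))) (Ideal.mul_mem_left _ _ (h3 _ _ _)))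
        (Ideal.mul_mem_right _ _ hh)
    fin_cases n
    · exact ⟨0, a, 0, b, c, 0, _, hr, by simp; ring⟩
    · exact ⟨0, 0, a, 0, b, c, _, hr, by simp; ring⟩

/-- The linear change of variables with a given invertible matrix. -/
lemma exists_isLinChange_symm (s t s' t' : K) (hdet : s * t' - t * s' ≠ 0) :
    ∃ φ : Pxy K ≃ₐ[K] Pxy K, IsLinChange φ ∧ φ.symm (X 0) = C s * X 0 + C t * X 1 ∧
      φ.symm (X 1) = C s' * X 0 + C t' * X 1 := by
  set D := s * t' - t * s' with hD
  let φ : Pxy K →ₐ[K] Pxy K := aeval ![C (t' / D) * X 0 + C (-t / D) * X 1,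
    C (-s' / D) * X 0 + C (s / D) * X 1]
  let ψ : Pxy K →ₐ[K] Pxy K := aeval ![C s * X 0 + C t * X 1, C s' * X 0 + C t' * X 1]
  have e1 : t' / D * s + -t / D * s' = 1 := by field_simp; rw [hD]; ring
  have e2 : t' / D * t + -t / D * t' = 0 := by field_simp; ring
  have e3 : -s' / D * s + s / D * s' = 0 := by field_simp; ring
  have e4 : -s' / D * t + s / D * t' = 1 := by field_simp; rw [hD]; ring
  have comb : ∀ a b c d a' b' : K, C a * (C c * X 0 + C d * X 1) + C b * (C a' * X 0 + C b' * X 1)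
      = (C (a * c + b * a') * X 0 + C (a * d + b * b') * X 1 : Pxy K) := by
    intros; simp only [C_add, C_mul]; ring
  have hC : ∀ (a : K) (χ : Pxy K →ₐ[K] Pxy K), χ (C a) = C a := fun a χ => χ.commutes a
  have f1 : s * (t' / D) + t * (-s' / D) = 1 := by field_simp; rw [hD]; ring
  have f2 : s * (-t / D) + t * (s / D) = 0 := by field_simp; ring
  have f3 : s' * (t' / D) + t' * (-s' / D) = 0 := by field_simp; ring
  have f4 : s' * (-t / D) + t' * (s / D) = 1 := by field_simp; rw [hD]; ring
  have φ0 : φ (X 0) = C (t' / D) * X 0 + C (-t / D) * X 1 := by simp [φ]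
  have φ1 : φ (X 1) = C (-s' / D) * X 0 + C (s / D) * X 1 := by simp [φ]
  have ψ0 : ψ (X 0) = C s * X 0 + C t * X 1 := by simp [ψ]
  have ψ1 : ψ (X 1) = C s' * X 0 + C t' * X 1 := by simp [ψ]
  refine ⟨AlgEquiv.ofAlgHom φ ψ ?_ ?_, ?_, ψ0, ψ1⟩
  · ext1 i
    fin_cases i
    · simp [ψ0, φ0, φ1, hC, comb, f1, f2]
    · simp [ψ1, φ0, φ1, hC, comb, f3, f4]
  · ext1 i
    fin_cases i
    · simp [φ0, ψ0, ψ1, hC, comb, e1, e2]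
    · simp [φ1, ψ0, ψ1, hC, comb, e3, e4]
  · have hlin : ∀ a b : K, (C a * X 0 + C b * X 1 : Pxy K).IsHomogeneous 1 := fun a b =>
      (isHomogeneous_C_mul_X _ _).add (isHomogeneous_C_mul_X _ _)
    intro i
    fin_cases i
    · simpa [φ0] using hlin _ _
    · simpa [φ1] using hlin _ _

/-- A nonzero symmetric bilinear form on `K²` has, in a suitable basis, matrix
`!![0, *; *, 0]` or `!![*, 0; 0, 0]`. -/
lemma exists_basis_of_symm_form [IsAlgClosed K] [CharZero K] (p q r : K)
    (h : ¬(p = 0 ∧ q = 0 ∧ r = 0)) :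
    ∃ s t s' t' : K, s * t' - t * s' ≠ 0 ∧
      p * s' * s' + q * (s' * t' + t' * s') + r * t' * t' = 0 ∧
      ((p * s * s + q * (s * t + t * s) + r * t * t = 0 ∧
        p * s * s' + q * (s * t' + t * s') + r * t * t' ≠ 0) ∨
      (p * s * s + q * (s * t + t * s) + r * t * t ≠ 0 ∧
        p * s * s' + q * (s * t' + t * s') + r * t * t' = 0)) := by
  have two : (2 : K) ≠ 0 := two_ne_zero
  by_cases hp : p = 0
  · subst hp
    by_cases hq : q = 0
    · subst hq
      have hr : r ≠ 0 := fun hr => h ⟨rfl, rfl, hr⟩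
      exact ⟨0, 1, 1, 0, by simp, by ring, Or.inr ⟨by simpa using hr, by ring⟩⟩
    · refine ⟨1, 0, r, -(2 * q), ?_, by ring, Or.inl ⟨by ring, ?_⟩⟩
      · simp [hq]
      · simp [hq]
  · obtain ⟨s, hs⟩ := IsAlgClosed.exists_pow_nat_eq (q ^ 2 - p * r) (n := 2) (by norm_num)
    by_cases h0 : s = 0
    · have hd : p * r = q ^ 2 := by
        rw [h0] at hs
        linear_combination hs
      refine ⟨1, 0, -q, p, by simpa using hp, by linear_combination p * hd,
        Or.inr ⟨by simpa using hp, by ring⟩⟩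
    · refine ⟨-q + s, p, -q - s, p, ?_, by linear_combination p * hs,
        Or.inl ⟨by linear_combination p * hs, ?_⟩⟩
      · rw [show (-q + s) * p - p * (-q - s) = 2 * s * p by ring]
        exact mul_ne_zero (mul_ne_zero two h0) hp
      · rw [show p * (-q + s) * (-q - s) + q * ((-q + s) * p + p * (-q - s)) + r * p * p =
          -2 * p * s ^ 2 by linear_combination p * hs]
        exact mul_ne_zero (mul_ne_zero (neg_ne_zero.mpr two) hp) (pow_ne_zero _ h0)

/-- Here `m₁, m₂, m₃` are the three quadratic monomials in some order. -/
lemma map_eq_span_add {I : Ideal (Pxy K)} (hI : IsHomog I) (h1 : hilb K I 1 = 2)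
    (h3 : hilb K I 3 = 0) {φ : Pxy K ≃ₐ[K] Pxy K}
    (hφ0 : (φ.symm (X 0)).IsHomogeneous 1) (hφ1 : (φ.symm (X 1)).IsHomogeneous 1)
    {m₁ m₂ m₃ : Pxy K} (hm : ∀ d e f : K, ∃ d' e' f' : K,
      C d * (X 0 * X 0) + C e * (X 0 * X 1) + C f * (X 1 * X 1) =
        C d' * m₁ + C e' * m₂ + C f' * m₃)
    (hm₁ : φ.symm m₁ ∈ I) (hm₂ : φ.symm m₂ ∈ I)
    (hh₃ : (φ.symm m₃).IsHomogeneous 2) (hm₃ : φ.symm m₃ ∉ I) :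
    Ideal.map φ I = Ideal.span {m₁, m₂} + Ideal.span {X 0, X 1} ^ 3 := by
  have hC : ∀ a : K, φ.symm (C a) = C a := fun a => φ.symm.commutes a
  have hcube : Ideal.span {(X 0 : Pxy K), X 1} ^ 3 ≤ I :=
    span_X_pow_le_of_homogeneousSubmodule_le fun f hf => mem_of_hilb_eq_zero h3 hf
  have hlin : ∀ f : Pxy K, f.IsHomogeneous 1 → f ∈ Ideal.span {(X 0 : Pxy K), X 1} := by
    intro f hf
    have hs : homogeneousSubmodule (Fin 2) K 1 ≤
        (Ideal.span {(X 0 : Pxy K), X 1}).restrictScalars K := by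
      rw [homogeneousSubmodule_one_eq_span_X, Submodule.span_le]
      rintro _ ⟨i, rfl⟩
      apply Ideal.subset_span
      fin_cases i <;> simp
    exact hs hf
  have hcube' : ∀ h ∈ Ideal.span {(X 0 : Pxy K), X 1} ^ 3, φ.symm h ∈ I := by
    intro h hh
    apply hcube
    have hmem := Ideal.mem_map_of_mem φ.symm hh
    rw [Ideal.map_pow] at hmem
    refine Ideal.pow_right_mono ?_ 3 hmem
    rw [Ideal.map_span, Ideal.span_le]
    rintro _ ⟨x, rfl | rfl, rfl⟩
    exacts [hlin _ hφ0, hlin _ hφ1]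
  have hmap : ∀ g, g ∈ Ideal.map φ I ↔ φ.symm g ∈ I := by
    intro g
    rw [Ideal.mem_map_of_equiv]
    exact ⟨by rintro ⟨x, hx, rfl⟩; simpa using hx, fun hg => ⟨_, hg, by simp⟩⟩
  apply le_antisymm
  · intro g hg
    rw [hmap] at hg
    obtain ⟨a, b, c, d, e, f, h, hh, rfl⟩ := exists_eq_quadratic_add g
    obtain ⟨d', e', f', hdef⟩ := hm d e f
    rw [hdef] at hg ⊢
    set u := φ.symm (X 0)
    set v := φ.symm (X 1)
    set l := C b * u + C c * v with hl
    have hlh : l.IsHomogeneous 1 := (hφ0.C_mul b).add (hφ1.C_mul c)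
    have hq : (C f' * φ.symm m₃).IsHomogeneous 2 := hh₃.C_mul f'
    have hsum : C a + l + C f' * φ.symm m₃ ∈ I := by
      have hsub := Ideal.sub_mem _ (Ideal.sub_mem _ hg (hcube' h hh))
        (Ideal.add_mem _ (Ideal.mul_mem_left I (C d') hm₁) (Ideal.mul_mem_left I (C e') hm₂))
      convert hsub using 1
      simp only [map_add, map_mul, hC, hl]
      ring
    have comp : ∀ k, homogeneousComponent k (C a + l + C f' * φ.symm m₃) =
        (if k = 0 then C a else 0) + (if k = 1 then l else 0) +
          (if k = 2 then C f' * φ.symm m₃ else 0) := by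
      intro k
      rw [map_add, map_add, homogeneousComponent_of_mem (isHomogeneous_C _ a),
        homogeneousComponent_of_mem hlh, homogeneousComponent_of_mem hq]
    have c0 : C a ∈ I := by simpa [comp] using hI _ hsum 0
    have c1 : l ∈ I := by simpa [comp] using hI _ hsum 1
    have c2 : C f' * φ.symm m₃ ∈ I := by simpa [comp] using hI _ hsum 2
    have hf' : f' = 0 := by
      by_contra hne
      apply hm₃
      have := Ideal.mul_mem_left I (C f'⁻¹) c2
      rwa [← mul_assoc, ← C_mul, inv_mul_cancel₀ hne, C_1, one_mul] at this
    have ha : a = 0 := by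
      have := eq_zero_of_hilb_one_eq_two h1 (isHomogeneous_C_mul_X a 0)
        (Ideal.mul_mem_right _ _ c0)
      simpa using this
    have hlz : C b * X 0 + C c * X 1 = (0 : Pxy K) := by
      apply φ.symm.injective
      have := eq_zero_of_hilb_one_eq_two h1 hlh c1
      simpa [hC] using this
    rw [hlz, ha, hf', C_0, zero_add, zero_mul, zero_add, add_zero]
    exact Submodule.add_mem_sup (Ideal.add_mem _
      (Ideal.mul_mem_left _ _ (Ideal.subset_span (by simp)))
      (Ideal.mul_mem_left _ _ (Ideal.subset_span (by simp)))) hh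
  · refine sup_le ?_ fun h hh => (hmap h).mpr (hcube' h hh)
    rw [Ideal.span_le]
    rintro _ (rfl | rfl)
    exacts [(hmap _).mpr hm₁, (hmap _).mpr hm₂]

end Auxiliary

/-- A homogeneous ideal of type `(1, 2, 1)` can be brought, by a linear change of
variables, to `(x², y²) + (x,y)³` or to `(xy, y²) + (x,y)³`. -/
theorem stmt5 (K : Type*) [Field K] [IsAlgClosed K] [CharZero K]
    (I : Ideal (Pxy K)) (hI : IsHomog I)
    (h0 : hilb K I 0 = 1) (h1 : hilb K I 1 = 2) (h2 : hilb K I 2 = 1)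
    (h3 : ∀ k, 3 ≤ k → hilb K I k = 0) :
    ∃ φ : Pxy K ≃ₐ[K] Pxy K, IsLinChange φ ∧
      (Ideal.map φ I =
          Ideal.span {(X 0 : Pxy K) ^ 2, X 1 ^ 2} + (Ideal.span {X 0, X 1}) ^ 3 ∨
       Ideal.map φ I =
          Ideal.span {(X 0 : Pxy K) * X 1, X 1 ^ 2} + (Ideal.span {X 0, X 1}) ^ 3) := by
  obtain ⟨L, hL, f, hf, hfL⟩ := exists_functional_of_hilb_eq_one h2
  obtain ⟨s, t, s', t', hdet, hvv, hcase⟩ := exists_basis_of_symm_form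
    (L (X 0 * X 0)) (L (X 0 * X 1)) (L (X 1 * X 1))
    fun h => hfL (map_eq_zero_of_isHomogeneous_two L h.1 h.2.1 h.2.2 hf)
  obtain ⟨φ, hφ, hφ0, hφ1⟩ := exists_isLinChange_symm s t s' t' hdet
  have hlin : ∀ a b : K, (C a * X 0 + C b * X 1 : Pxy K).IsHomogeneous 1 := fun a b =>
    (isHomogeneous_C_mul_X _ _).add (isHomogeneous_C_mul_X _ _)
  have hprod : ∀ a b c d : K, L ((C a * X 0 + C b * X 1) * (C c * X 0 + C d * X 1)) =
      L (X 0 * X 0) * a * c + L (X 0 * X 1) * (a * d + b * c) + L (X 1 * X 1) * b * d := by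
    intro a b c d
    have : (C a * X 0 + C b * X 1) * (C c * X 0 + C d * X 1) =
        (a * c) • (X 0 * X 0) + (a * d + b * c) • (X 0 * X 1) +
          (b * d) • (X 1 * X 1 : Pxy K) := by
      simp only [smul_eq_C_mul, C_add, C_mul]; ring
    rw [this]
    simp only [map_add, map_smul, smul_eq_mul]
    ring
  have hmem : ∀ a b c d : K, (C a * X 0 + C b * X 1) * (C c * X 0 + C d * X 1) ∈ I ↔
      L (X 0 * X 0) * a * c + L (X 0 * X 1) * (a * d + b * c) + L (X 1 * X 1) * b * d = 0 := by
    intro a b c d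
    rw [← hprod, hL _ ((hlin a b).mul (hlin c d))]
  have hφ0' : (φ.symm (X 0)).IsHomogeneous 1 := hφ0 ▸ hlin s t
  have hφ1' : (φ.symm (X 1)).IsHomogeneous 1 := hφ1 ▸ hlin s' t'
  have hv : φ.symm (X 1 ^ 2) ∈ I := by rw [pow_two, map_mul, hφ1, hmem]; exact hvv
  refine ⟨φ, hφ, hcase.imp ?_ ?_⟩
  · rintro ⟨huu, huv⟩
    refine map_eq_span_add (m₃ := X 0 * X 1) hI h1 (h3 3 le_rfl) hφ0' hφ1'
      (fun d e f => ⟨d, f, e, by ring⟩) ?_ hv ?_ ?_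
    · rw [pow_two, map_mul, hφ0, hmem]; exact huu
    · rw [map_mul]; exact hφ0'.mul hφ1'
    · rw [map_mul, hφ0, hφ1, hmem]; exact huv
  · rintro ⟨huu, huv⟩
    refine map_eq_span_add (m₃ := X 0 * X 0) hI h1 (h3 3 le_rfl) hφ0' hφ1'
      (fun d e f => ⟨e, f, d, by ring⟩) ?_ hv ?_ ?_
    · rw [map_mul, hφ0, hφ1, hmem]; exact huv
    · rw [map_mul]; exact hφ0'.mul hφ0'
    · rw [map_mul, hφ0, hmem]; exact huu
end
end

section
/- Let K be an algebraically closed field, let I be a homogeneous ideal of K[x,y], and let n, s be natural numbers with s ≤ n. Suppose dim_K (K[x,y]_n / (I ∩ K[x,y]_n)) = s and dim_K (K[x,y]_{n+1} / (I ∩ K[x,y]_{n+1})) = s. Then there exists a homogeneous polynomial h of degree s such that I ∩ K[x,y]_n = h·K[x,y]_{n−s}. -/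
open MvPolynomial

noncomputable section

open Module in
theorem Submodule.exists_le_finrank_eq {K M : Type*} [Field K] [AddCommGroup M] [Module K M]
    (U : Submodule K M) {k : ℕ} (hk : k ≤ finrank K U) :
    ∃ W ≤ U, finrank K W = k := by
  obtain ⟨v, hv⟩ := exists_linearIndependent_of_le_finrank hk
  have hv' : LinearIndependent K fun i => (v i : M) := hv.map' U.subtype U.ker_subtype
  refine ⟨Submodule.span K (Set.range fun i => (v i : M)), ?_, ?_⟩
  · rw [Submodule.span_le]
    rintro _ ⟨i, rfl⟩
    exact (v i).2
  · simpa using finrank_span_eq_card hv'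

namespace MvPolynomial

open Module

variable {K : Type*} [Field K]

theorem finrank_homogeneousSubmodule_fin_two (n : ℕ) :
    finrank K (homogeneousSubmodule (Fin 2) K n) = n + 1 := by
  have e : {d : Fin 2 →₀ ℕ | d.degree = n} ≃ Finset.HasAntidiagonal.antidiagonal n :=
    { toFun := fun d => ⟨(d.1 0, d.1 1), by
        have := d.2
        simpa [Finsupp.degree_eq_sum] using this⟩
      invFun := fun p => ⟨Finsupp.equivFunOnFinite.symm ![p.1.1, p.1.2], by
        have := Finset.HasAntidiagonal.mem_antidiagonal.mp p.2
        rwa [Set.mem_ofPred_eq, Finsupp.degree_eq_sum, Fin.sum_univ_two]⟩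
      left_inv := fun d => by
        ext i
        fin_cases i <;> simp
      right_inv := fun p => by simp }
  have := Fintype.ofEquiv _ e.symm
  rw [homogeneousSubmodule_eq_finsupp_supported,
    (AddMonoidAlgebra.supportedEquivFinsupp _).finrank_eq, finrank_finsupp_self,
    Fintype.card_congr e]
  simp

instance finite_homogeneousSubmodule {σ : Type*} [Finite σ] (n : ℕ) :
    Module.Finite K (homogeneousSubmodule σ K n) :=
  Module.Finite.iff_fg.mpr (homogeneousSubmodule_fg σ K n)

theorem homogeneousSubmodule_succ_le {r : ℕ} {W : Submodule K (MvPolynomial (Fin 2) K)}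
    {h : MvPolynomial (Fin 2) K}
    (hW : ∀ i, ∀ q ∈ homogeneousSubmodule (Fin 2) K r, X i * (h * q) ∈ W) :
    (homogeneousSubmodule (Fin 2) K (r + 1)).map (LinearMap.mulLeft K h) ≤ W := by
  rw [Submodule.map_le_iff_le_comap, ← homogeneousSubmodule_one_pow, pow_succ',
    homogeneousSubmodule_one_pow, homogeneousSubmodule_one_eq_span_X, Submodule.mul_le]
  intro p hp q hq
  induction hp using Submodule.span_induction with
  | mem p hp =>
    obtain ⟨i, rfl⟩ := hp
    simpa [mul_left_comm] using hW i q hq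
  | zero => simp
  | add a b _ _ ha hb => rw [add_mul]; exact add_mem ha hb
  | smul c a _ ha => rw [smul_mul_assoc]; exact Submodule.smul_mem _ c ha

theorem finrank_map_mulLeft {σ : Type*} {h : MvPolynomial σ K} (hh : h ≠ 0)
    (V : Submodule K (MvPolynomial σ K)) :
    finrank K (V.map (LinearMap.mulLeft K h)) = finrank K V :=
  (Submodule.equivMapOfInjective _ (mul_right_injective₀ hh) V).finrank_eq.symm

/-- A finite-dimensional space of polynomials in two variables whose dimension grows by at most
one under multiplication by the linear forms consists of the degree `r` multiples of some `h`. -/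
theorem exists_eq_map_mulLeft_of_finrank_sup_le (r : ℕ)
    (V : Submodule K (MvPolynomial (Fin 2) K)) (hV : finrank K V = r + 1)
    (hV' : finrank K ↥(V.map (LinearMap.mulLeft K (X 0)) ⊔ V.map (LinearMap.mulLeft K (X 1)))
      ≤ r + 2) :
    ∃ h ≠ 0, V = (homogeneousSubmodule (Fin 2) K r).map (LinearMap.mulLeft K h) := by
  induction r generalizing V with
  | zero =>
    have : FiniteDimensional K V := FiniteDimensional.of_finrank_pos (by omega)
    obtain ⟨v, hv, hspan⟩ := finrank_eq_one_iff'.mp hV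
    refine ⟨v, by simpa using hv, ?_⟩
    ext w
    simp only [homogeneousSubmodule_zero, Submodule.mem_map, Submodule.mem_one,
      LinearMap.mulLeft_apply]
    constructor
    · intro hw
      obtain ⟨c, hc⟩ := hspan ⟨w, hw⟩
      refine ⟨C c, ⟨c, rfl⟩, ?_⟩
      rw [mul_comm, ← smul_eq_C_mul]
      exact congrArg Subtype.val hc
    · rintro ⟨_, ⟨c, rfl⟩, rfl⟩
      rw [algebraMap_eq, mul_comm, ← smul_eq_C_mul]
      exact V.smul_mem c v.2
  | succ r ih =>
    have : FiniteDimensional K V := FiniteDimensional.of_finrank_pos (by omega)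
    let U : Submodule K (MvPolynomial (Fin 2) K) :=
      V.comap (LinearMap.mulLeft K (X 0)) ⊓ V.comap (LinearMap.mulLeft K (X 1))
    have hX (i : Fin 2) : (X i : MvPolynomial (Fin 2) K) ≠ 0 := X_ne_zero i
    have hinf : V.map (LinearMap.mulLeft K (X 0)) ⊓ V.map (LinearMap.mulLeft K (X 1)) ≤
        U.map (LinearMap.mulLeft K (X 0 * X 1)) := by
      rintro _ ⟨⟨a, ha, rfl⟩, ⟨b, hb, hab⟩⟩
      simp only [LinearMap.mulLeft_apply] at hab ⊢
      have hdvd : (X 1 : MvPolynomial (Fin 2) K) ∣ X 0 * a := ⟨b, hab.symm⟩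
      rw [X_dvd_mul_iff, X_dvd_X] at hdvd
      obtain ⟨u, rfl⟩ := hdvd.resolve_left (by simp)
      have hbu : b = X 0 * u := mul_left_cancel₀ (hX 1) (by rw [hab]; ring)
      subst hbu
      exact ⟨u, ⟨hb, ha⟩, by simp⟩
    have hUV (i : Fin 2) : U.map (LinearMap.mulLeft K (X i)) ≤ V := by
      rw [Submodule.map_le_iff_le_comap]
      fin_cases i
      exacts [inf_le_left, inf_le_right]
    have : FiniteDimensional K (U.map (LinearMap.mulLeft K (X 0))) :=
      Submodule.finiteDimensional_of_le (hUV 0)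
    have : FiniteDimensional K U :=
      Module.Finite.equiv
        (Submodule.equivMapOfInjective (LinearMap.mulLeft K (X 0)) (mul_right_injective₀ (hX 0)) U).symm
    have hUr : r + 1 ≤ finrank K U := by
      have h₁ := Submodule.finrank_mono hinf
      have h₂ := Submodule.finrank_sup_add_finrank_inf_eq
        (V.map (LinearMap.mulLeft K (X 0))) (V.map (LinearMap.mulLeft K (X 1)))
      rw [finrank_map_mulLeft (mul_ne_zero (hX 0) (hX 1))] at h₁
      rw [finrank_map_mulLeft (hX 0), finrank_map_mulLeft (hX 1)] at h₂
      omega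
    obtain ⟨W, hWU, hW⟩ := U.exists_le_finrank_eq hUr
    have hWV (i : Fin 2) : W.map (LinearMap.mulLeft K (X i)) ≤ V :=
      (Submodule.map_mono hWU).trans (hUV i)
    obtain ⟨h, hh, rfl⟩ := ih W hW
      ((Submodule.finrank_mono (sup_le (hWV 0) (hWV 1))).trans (by omega))
    refine ⟨h, hh, (Submodule.eq_of_le_of_finrank_eq (homogeneousSubmodule_succ_le ?_) ?_).symm⟩
    · intro i q hq
      exact hWV i ⟨_, ⟨q, hq, rfl⟩, rfl⟩
    · rw [finrank_map_mulLeft hh, finrank_homogeneousSubmodule_fin_two, hV]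

theorem IsHomogeneous.of_mul_X_pow {R σ : Type*} [CommSemiring R] {h : MvPolynomial σ R} {i : σ}
    {r s : ℕ} (H : (h * X i ^ r).IsHomogeneous (s + r)) : h.IsHomogeneous s := by
  intro d hd
  have hc : coeff (d + Finsupp.single i r) (h * X i ^ r) ≠ 0 := by
    rwa [X_pow_eq_monomial, coeff_mul_monomial, mul_one]
  have := H hc
  simpa [Finsupp.weight_single] using this

end MvPolynomial

open Module in
theorem hilb_add_finrank_inf {K : Type*} [Field K] (I : Ideal (Pxy K)) (k : ℕ) :
    hilb K I k + finrank K ↥(I.restrictScalars K ⊓ homogeneousSubmodule (Fin 2) K k) = k + 1 := by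
  have h := Submodule.finrank_quotient_add_finrank
    (Submodule.comap (homogeneousSubmodule (Fin 2) K k).subtype (I.restrictScalars K))
  rw [finrank_homogeneousSubmodule_fin_two, ← Submodule.finrank_map_subtype_eq,
    Submodule.map_comap_subtype, inf_comm] at h
  exact h

/-- If `dim K[x,y]_n/(I ∩ K[x,y]_n) = dim K[x,y]_{n+1}/(I ∩ K[x,y]_{n+1}) = s`,
then `I ∩ K[x,y]_n = h·K[x,y]_{n-s}` for some homogeneous `h` of degree `s`. -/
theorem stmt7 (K : Type*) [Field K] [IsAlgClosed K]
    (I : Ideal (Pxy K)) (hI : IsHomog I) (n s : ℕ) (hs : s ≤ n)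
    (h1 : hilb K I n = s) (h2 : hilb K I (n + 1) = s) :
    ∃ h : Pxy K, h.IsHomogeneous s ∧
      I.restrictScalars K ⊓ homogeneousSubmodule (Fin 2) K n =
        Submodule.map (LinearMap.mulLeft K h)
          (homogeneousSubmodule (Fin 2) K (n - s)) := by
  have hd₁ := hilb_add_finrank_inf I n
  have hd₂ := hilb_add_finrank_inf I (n + 1)
  have hle (i : Fin 2) :
      (I.restrictScalars K ⊓ homogeneousSubmodule (Fin 2) K n).map (LinearMap.mulLeft K (X i)) ≤
        I.restrictScalars K ⊓ homogeneousSubmodule (Fin 2) K (n + 1) := by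
    rintro _ ⟨f, ⟨hfI, hfn⟩, rfl⟩
    exact ⟨I.mul_mem_left _ hfI, add_comm 1 n ▸ (isHomogeneous_X K i).mul hfn⟩
  have : FiniteDimensional K
      ↥(I.restrictScalars K ⊓ homogeneousSubmodule (Fin 2) K (n + 1)) :=
    Submodule.finiteDimensional_of_le inf_le_right
  rw [h1] at hd₁
  rw [h2] at hd₂
  obtain ⟨h, -, heq⟩ := exists_eq_map_mulLeft_of_finrank_sup_le (n - s) _
    (show _ = n - s + 1 by rw [← Nat.sub_add_comm hs]; exact Nat.eq_sub_of_add_eq' hd₁)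
    ((Submodule.finrank_mono (sup_le (hle 0) (hle 1))).trans
      (show _ ≤ n - s + 2 by rw [← Nat.sub_add_comm hs]; exact (Nat.eq_sub_of_add_eq' hd₂).le))
  refine ⟨h, ?_, heq⟩
  have hmem : h * X 0 ^ (n - s) ∈ I.restrictScalars K ⊓ homogeneousSubmodule (Fin 2) K n :=
    heq ▸ ⟨_, isHomogeneous_X_pow 0 (n - s), rfl⟩
  exact IsHomogeneous.of_mul_X_pow (i := 0) (r := n - s) (by
    rw [Nat.add_sub_cancel' hs]
    exact hmem.2)
end
end

section
/- Let K be an algebraically closed field of characteristic 0, let n ≥ 3, k ≥ 1, l ≥ 2. Let t : ℕ → ℕ be given by t(i) = i+1 for 0 ≤ i ≤ n−1, t(j) = 3 for n ≤ j ≤ n+k, t(j) = 2 for n+k+1 ≤ j ≤ n+k+l, and t(j) = 0 for j > n+k+l. Then there exist finitely many homogeneous ideals J_1, …, J_m of K[x,y] such that every homogeneous ideal I of K[x,y] with t_I = t satisfies φ(I) = J_i for some linear change of variables φ and some i. -/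
open MvPolynomial

noncomputable section

namespace BinaryForms

variable {K : Type*} [Field K]

lemma isHomogeneous_of_mul_left {g h : Pxy K} {i j : ℕ} (hg : g.IsHomogeneous i) (hg0 : g ≠ 0)
    (hgh : (g * h).IsHomogeneous (i + j)) : h.IsHomogeneous j := by
  let _ : GradedAlgebra (homogeneousSubmodule (Fin 2) K) := MvPolynomial.gradedAlgebra
  have key := DirectSum.coe_decompose_mul_add_of_left_mem (homogeneousSubmodule (Fin 2) K)
    (j := j) (b := h) ((mem_homogeneousSubmodule i g).2 hg)
  rw [DirectSum.decompose_of_mem_same _ hgh] at key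
  rw [mul_left_cancel₀ hg0 key]
  exact (mem_homogeneousSubmodule j _).1 (SetLike.coe_mem _)

lemma finrank_homogeneousSubmodule (d : ℕ) :
    Module.finrank K (homogeneousSubmodule (Fin 2) K d) = d + 1 := by
  let e : {m : Fin 2 →₀ ℕ | m.degree = d} ≃ Fin (d + 1) :=
    { toFun := fun m => ⟨m.1 0, by
        have := m.2
        simp only [Set.mem_ofPred_eq, Finsupp.degree_eq_sum, Fin.sum_univ_two] at this
        omega⟩
      invFun := fun a => ⟨Finsupp.single 0 a.1 + Finsupp.single 1 (d - a.1), by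
        have := a.2
        simp [Finsupp.degree_eq_sum, Fin.sum_univ_two]
        omega⟩
      left_inv := by
        rintro ⟨m, hm⟩
        simp only [Set.mem_ofPred_eq, Finsupp.degree_eq_sum, Fin.sum_univ_two] at hm
        ext i
        fin_cases i
        · simp
        · simp
          omega
      right_inv := by
        rintro ⟨a, ha⟩
        simp }
  rw [homogeneousSubmodule_eq_finsupp_supported]
  let E := (AddMonoidAlgebra.supportedEquivFinsupp (R := K) (S := K)
    {m : Fin 2 →₀ ℕ | m.degree = d}).trans (Finsupp.domLCongr e)
  exact E.finrank_eq.trans (by rw [Module.finrank_finsupp_self, Fintype.card_fin])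

instance finiteDimensional_homogeneousSubmodule (d : ℕ) :
    FiniteDimensional K (homogeneousSubmodule (Fin 2) K d) :=
  Module.finite_of_finrank_pos (by rw [finrank_homogeneousSubmodule]; omega)

lemma exists_eq_X_mul_add_X_mul {p : Pxy K} {d : ℕ} (hp : p.IsHomogeneous (d + 1)) :
    ∃ q r : Pxy K, q.IsHomogeneous d ∧ r.IsHomogeneous d ∧ p = X 0 * q + X 1 * r := by
  let Q : Submodule K (Pxy K) :=
    (homogeneousSubmodule (Fin 2) K d).map (LinearMap.mulLeft K (X 0)) ⊔
      (homogeneousSubmodule (Fin 2) K d).map (LinearMap.mulLeft K (X 1))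
  suffices h : p ∈ Q by
    obtain ⟨a, ⟨q, hq, rfl⟩, b, ⟨r, hr, rfl⟩, rfl⟩ := Submodule.mem_sup.1 h
    exact ⟨q, r, hq, hr, rfl⟩
  rw [p.as_sum]
  refine Submodule.sum_mem _ fun m hm => ?_
  have hdeg : m.degree = d + 1 := by
    by_contra hne
    exact mem_support_iff.1 hm (hp.coeff_eq_zero hne)
  have hX (i : Fin 2) (hi : m i ≠ 0) : ∃ q : Pxy K, q.IsHomogeneous d ∧
      X i * q = monomial m (coeff m p) := by
    have hle : Finsupp.single i 1 ≤ m := by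
      rw [Finsupp.single_le_iff]; omega
    obtain ⟨m', rfl⟩ := exists_add_of_le hle
    refine ⟨monomial m' (coeff (Finsupp.single i 1 + m') p), isHomogeneous_monomial _ ?_, ?_⟩
    · rw [map_add, Finsupp.degree_single] at hdeg; omega
    · rw [X, monomial_mul, one_mul]
  by_cases h0 : m 0 = 0
  · have h1 : m 1 ≠ 0 := by
      rw [Finsupp.degree_eq_sum, Fin.sum_univ_two] at hdeg; omega
    obtain ⟨q, hq, hqm⟩ := hX 1 h1
    exact Submodule.mem_sup_right ⟨q, hq, hqm⟩
  · obtain ⟨q, hq, hqm⟩ := hX 0 h0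
    exact Submodule.mem_sup_left ⟨q, hq, hqm⟩

lemma mulLeft_injective {f : Pxy K} (hf : f ≠ 0) : Function.Injective (LinearMap.mulLeft K f) :=
  fun _ _ h => mul_left_cancel₀ hf h

lemma finrank_map_mulLeft {f : Pxy K} (hf : f ≠ 0) (V : Submodule K (Pxy K)) :
    Module.finrank K (V.map (LinearMap.mulLeft K f)) = Module.finrank K V :=
  (Submodule.equivMapOfInjective _ (mulLeft_injective hf) V).finrank_eq.symm

lemma exists_le_finrank_eq {V : Submodule K (Pxy K)} {d : ℕ} (h : d ≤ Module.finrank K V) :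
    ∃ U ≤ V, Module.finrank K U = d := by
  obtain ⟨b, hb⟩ := exists_linearIndependent_of_le_finrank h
  refine ⟨Submodule.span K (Set.range fun i => (b i : Pxy K)), ?_, ?_⟩
  · rw [Submodule.span_le]
    rintro _ ⟨i, rfl⟩
    exact (b i).2
  · exact (finrank_span_eq_card (hb.map' V.subtype V.ker_subtype)).trans (Fintype.card_fin d)

/-- Macaulay's minimal growth for spaces of binary forms: a space `V` of forms of degree `j` with
`dim (x V + y V) ≤ dim V + 1` consists of all multiples of a fixed form. -/
lemma exists_eq_map_mulLeft (d : ℕ) : ∀ (j : ℕ) (V W : Submodule K (Pxy K)),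
    V ≤ homogeneousSubmodule (Fin 2) K j → Module.finrank K V = d + 1 →
    FiniteDimensional K W → Module.finrank K W ≤ d + 2 →
    (∀ i : Fin 2, ∀ v ∈ V, X i * v ∈ W) →
    ∃ (c : ℕ) (f : Pxy K), c + d = j ∧ f.IsHomogeneous c ∧ f ≠ 0 ∧
      V = (homogeneousSubmodule (Fin 2) K d).map (LinearMap.mulLeft K f) := by
  induction d with
  | zero =>
    intro j V W hV hVr _ _ _
    have := Submodule.finiteDimensional_of_le hV
    obtain ⟨⟨f, hf⟩, hf0, -⟩ := finrank_eq_one_iff'.1 hVr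
    have hf0 : f ≠ 0 := fun h => hf0 (Subtype.ext h)
    refine ⟨j, f, rfl, hV hf, hf0, ?_⟩
    symm
    refine Submodule.eq_of_le_of_finrank_eq ?_ ?_
    · rintro _ ⟨q, hq, rfl⟩
      rw [SetLike.mem_coe, homogeneousSubmodule_zero] at hq
      obtain ⟨a, rfl⟩ := Submodule.mem_one.1 hq
      rw [LinearMap.mulLeft_apply, mul_comm, ← Algebra.smul_def]
      exact V.smul_mem a hf
    · rw [finrank_map_mulLeft hf0, finrank_homogeneousSubmodule, hVr]
  | succ d ih =>
    intro j V W hV hVr _ hWr hVW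
    have := Submodule.finiteDimensional_of_le hV
    let U : Submodule K (Pxy K) :=
      V.comap (LinearMap.mulLeft K (X 0)) ⊓ V.comap (LinearMap.mulLeft K (X 1))
    have hX (i : Fin 2) : (X i : Pxy K) ≠ 0 := X_ne_zero i
    let A (i : Fin 2) := V.map (LinearMap.mulLeft K (X i))
    have hA (i : Fin 2) : A i ≤ W := by
      rintro _ ⟨v, hv, rfl⟩
      exact hVW i v hv
    have hdim := Submodule.finrank_sup_add_finrank_inf_eq (A 0) (A 1)
    have hsup : Module.finrank K ↥(A 0 ⊔ A 1) ≤ d + 3 :=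
      (Submodule.finrank_mono (sup_le (hA 0) (hA 1))).trans hWr
    have hAr (i : Fin 2) : Module.finrank K (A i) = d + 2 := by
      rw [finrank_map_mulLeft (hX i), hVr]
    rw [hAr, hAr] at hdim
    have hinf : A 0 ⊓ A 1 ≤ U.map (LinearMap.mulLeft K (X 0 * X 1)) := by
      rintro z ⟨⟨a, ha, rfl⟩, ⟨b, hb, hab⟩⟩
      simp only [LinearMap.mulLeft_apply] at hab
      have hdvd : (X 0 : Pxy K) ∣ X 1 * b := ⟨a, hab⟩
      rw [X_dvd_mul_iff] at hdvd
      obtain ⟨u, rfl⟩ : (X 0 : Pxy K) ∣ b := hdvd.resolve_left (by simp [X_dvd_X])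
      have hau : a = X 1 * u := by
        apply mul_left_cancel₀ (hX 0)
        rw [← hab]; ring
      refine ⟨u, ⟨hb, ?_⟩, ?_⟩
      · simpa [← hau] using ha
      · simp [hau]
    have hUle : U.map (LinearMap.mulLeft K (X 0)) ≤ V := by
      rintro _ ⟨u, hu, rfl⟩
      exact hu.1
    have hUfin : FiniteDimensional K U := by
      have := Submodule.finiteDimensional_of_le hUle
      exact LinearEquiv.finiteDimensional
        (Submodule.equivMapOfInjective _ (mulLeft_injective (hX 0)) U).symm
    have hUr : d + 1 ≤ Module.finrank K U := by
      have h1 := Submodule.finrank_mono hinf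
      rw [finrank_map_mulLeft (mul_ne_zero (hX 0) (hX 1))] at h1
      omega
    have hj : ∃ j', j = j' + 1 := by
      refine Nat.exists_eq_add_one.2 (Nat.pos_of_ne_zero ?_)
      rintro rfl
      have := Submodule.finrank_mono hV
      rw [finrank_homogeneousSubmodule] at this
      omega
    obtain ⟨j, rfl⟩ := hj
    obtain ⟨U', hU', hU'r⟩ := exists_le_finrank_eq hUr
    obtain ⟨c, f, hcd, hf, hf0, rfl⟩ := ih j U' V
      (fun u hu => isHomogeneous_of_mul_left (isHomogeneous_X K 0) (hX 0)
        (by rw [add_comm]; exact hV (hU' hu).1)) hU'r inferInstance hVr.le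
      (fun i u hu => by fin_cases i; exacts [(hU' hu).1, (hU' hu).2])
    refine ⟨c, f, by omega, hf, hf0, ?_⟩
    symm
    refine Submodule.eq_of_le_of_finrank_eq ?_ ?_
    · rintro _ ⟨p, hp, rfl⟩
      obtain ⟨q, r, hq, hr, rfl⟩ := exists_eq_X_mul_add_X_mul hp
      have h0 := (hU' ⟨q, hq, rfl⟩).1
      have h1 := (hU' ⟨r, hr, rfl⟩).2
      simp only [SetLike.mem_coe, Submodule.mem_comap, LinearMap.mulLeft_apply] at h0 h1 ⊢
      convert V.add_mem h0 h1 using 1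
      ring
    · rw [finrank_map_mulLeft hf0, finrank_homogeneousSubmodule, hVr]

/-- The ideal generated by the multiples of `f` of degree at least `p`, the multiples of `g` of
degree at least `q`, and all forms of degree at least `r`. -/
def truncIdeal (p q r : ℕ) (f g : Pxy K) : Ideal (Pxy K) :=
  Ideal.span {s | ∃ j, s.IsHomogeneous j ∧ (p ≤ j ∧ f ∣ s ∨ q ≤ j ∧ g ∣ s ∨ r ≤ j)}

lemma isHomog_truncIdeal (p q r : ℕ) (f g : Pxy K) : IsHomog (truncIdeal p q r f g) := by
  let _ : GradedAlgebra (homogeneousSubmodule (Fin 2) K) := MvPolynomial.gradedAlgebra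
  have h : (truncIdeal p q r f g).IsHomogeneous (homogeneousSubmodule (Fin 2) K) :=
    Ideal.homogeneous_span _ _ fun s ⟨j, hj, _⟩ => ⟨j, hj⟩
  exact fun s hs k => homogeneousComponent_mem_of_mem h hs k

lemma truncIdeal_congr (p q r : ℕ) {f f' g g' : Pxy K} (hf : Associated f f')
    (hg : Associated g g') : truncIdeal p q r f g = truncIdeal p q r f' g' := by
  simp only [truncIdeal, hf.dvd_iff_dvd_left, hg.dvd_iff_dvd_left]

lemma IsLinChange.isHomogeneous {φ : Pxy K ≃ₐ[K] Pxy K} (hφ : IsLinChange φ) {f : Pxy K} {d : ℕ}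
    (hf : f.IsHomogeneous d) : (φ f).IsHomogeneous d := by
  have h := hf.aeval (fun i => φ (X i)) hφ
  rw [one_mul] at h
  convert h using 1
  exact congrArg (· f) (aeval_unique φ.toAlgHom)

lemma map_truncIdeal_le (p q r : ℕ) {φ : Pxy K ≃ₐ[K] Pxy K} (hφ : IsLinChange φ) (f g : Pxy K) :
    (truncIdeal p q r f g).map φ ≤ truncIdeal p q r (φ f) (φ g) := by
  rw [truncIdeal, Ideal.map_span, Ideal.span_le]
  rintro _ ⟨s, ⟨j, hj, h⟩, rfl⟩
  refine Ideal.subset_span ⟨j, IsLinChange.isHomogeneous hφ hj, ?_⟩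
  rcases h with ⟨hp, h⟩ | ⟨hq, h⟩ | h
  · exact .inl ⟨hp, map_dvd φ h⟩
  · exact .inr (.inl ⟨hq, map_dvd φ h⟩)
  · exact .inr (.inr h)

lemma map_truncIdeal (p q r : ℕ) {φ : Pxy K ≃ₐ[K] Pxy K} (hφ : IsLinChange φ)
    (hφ' : IsLinChange φ.symm) (f g : Pxy K) :
    (truncIdeal p q r f g).map φ = truncIdeal p q r (φ f) (φ g) := by
  refine le_antisymm (map_truncIdeal_le p q r hφ f g) fun s hs => ?_
  have h := map_truncIdeal_le p q r hφ' (φ f) (φ g) (Ideal.mem_map_of_mem φ.symm hs)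
  rw [φ.symm_apply_apply, φ.symm_apply_apply] at h
  simpa using Ideal.mem_map_of_mem φ h

/-- The forms of degree `j` in `I`. -/
def degreePart (I : Ideal (Pxy K)) (j : ℕ) : Submodule K (Pxy K) :=
  homogeneousSubmodule (Fin 2) K j ⊓ I.restrictScalars K

instance finiteDimensional_degreePart (I : Ideal (Pxy K)) (j : ℕ) :
    FiniteDimensional K (degreePart I j) :=
  Submodule.finiteDimensional_of_le (inf_le_left : _ ≤ homogeneousSubmodule (Fin 2) K j)

lemma hilb_add_finrank_degreePart (I : Ideal (Pxy K)) (j : ℕ) :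
    hilb K I j + Module.finrank K (degreePart I j) = j + 1 := by
  have h := Submodule.finrank_quotient_add_finrank
    (Submodule.comap (homogeneousSubmodule (Fin 2) K j).subtype (I.restrictScalars K))
  rw [finrank_homogeneousSubmodule] at h
  rw [hilb, ← h, degreePart, ← Submodule.map_comap_subtype]
  congr 1
  exact (Submodule.equivMapOfInjective _ (Submodule.injective_subtype _) _).finrank_eq.symm

lemma X_mul_mem_degreePart {I : Ideal (Pxy K)} {j : ℕ} {s : Pxy K} (hs : s ∈ degreePart I j)
    (i : Fin 2) : X i * s ∈ degreePart I (j + 1) :=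
  ⟨by rw [add_comm]; exact (isHomogeneous_X K i).mul hs.1, I.mul_mem_left _ hs.2⟩

lemma exists_degreePart_eq {I : Ideal (Pxy K)} {c d : ℕ}
    (h : Module.finrank K (degreePart I (c + d)) = d + 1)
    (h' : Module.finrank K (degreePart I (c + d + 1)) = d + 2) :
    ∃ f : Pxy K, f.IsHomogeneous c ∧ f ≠ 0 ∧
      degreePart I (c + d) = (homogeneousSubmodule (Fin 2) K d).map (LinearMap.mulLeft K f) := by
  obtain ⟨c', f, hc, hf, hf0, hV⟩ := exists_eq_map_mulLeft d (c + d) (degreePart I (c + d))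
    (degreePart I (c + d + 1)) inf_le_left h inferInstance h'.le
    fun i v hv => X_mul_mem_degreePart hv i
  obtain rfl : c' = c := by omega
  exact ⟨f, hf, hf0, hV⟩

lemma mul_mem_of_le {I : Ideal (Pxy K)} {f : Pxy K} {d : ℕ}
    (h : ∀ s : Pxy K, s.IsHomogeneous d → f * s ∈ I) {e : ℕ} (hde : d ≤ e) :
    ∀ s : Pxy K, s.IsHomogeneous e → f * s ∈ I := by
  induction e, hde using Nat.le_induction with
  | base => exact h
  | succ e _ ih =>
    intro s hs
    obtain ⟨q, r, hq, hr, rfl⟩ := exists_eq_X_mul_add_X_mul hs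
    have := I.add_mem (I.mul_mem_left (X 0) (ih q hq)) (I.mul_mem_left (X 1) (ih r hr))
    convert this using 1
    ring

/-- If the forms of degree `c + d` in `I` are the multiples of `f`, the same holds in every higher
degree in which the Hilbert function is still `c`. -/
lemma mem_iff_dvd {I : Ideal (Pxy K)} {f : Pxy K} {c d : ℕ} (hf : f.IsHomogeneous c) (hf0 : f ≠ 0)
    (hV : degreePart I (c + d) = (homogeneousSubmodule (Fin 2) K d).map (LinearMap.mulLeft K f))
    {j : ℕ} (hj : c + d ≤ j) (hI : Module.finrank K (degreePart I j) + c = j + 1) {s : Pxy K}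
    (hs : s.IsHomogeneous j) : s ∈ I ↔ f ∣ s := by
  obtain ⟨e, rfl⟩ := Nat.exists_eq_add_of_le ((Nat.le_add_right c d).trans hj)
  have hmul := mul_mem_of_le (I := I) (f := f) (d := d) (fun s hs => by
    have : f * s ∈ degreePart I (c + d) := hV ▸ ⟨s, hs, rfl⟩
    exact this.2) (e := e) (by omega)
  constructor
  · have heq : (homogeneousSubmodule (Fin 2) K e).map (LinearMap.mulLeft K f) =
        degreePart I (c + e) := by
      refine Submodule.eq_of_le_of_finrank_eq ?_ ?_
      · rintro _ ⟨q, hq, rfl⟩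
        exact ⟨hf.mul hq, hmul q hq⟩
      · rw [finrank_map_mulLeft hf0, finrank_homogeneousSubmodule]; omega
    intro hsI
    obtain ⟨q, -, rfl⟩ := heq.ge ⟨hs, hsI⟩
    exact ⟨q, rfl⟩
  · rintro ⟨q, rfl⟩
    exact hmul q (isHomogeneous_of_mul_left hf hf0 hs)

lemma dvd_of_dvd_mul_X_pow {f g : Pxy K} {a b : ℕ} (h0 : g ∣ f * X 0 ^ a) (h1 : g ∣ f * X 1 ^ b) :
    g ∣ f := by
  let _ : GCDMonoid (Pxy K) := UniqueFactorizationMonoid.toGCDMonoid _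
  have hrel : IsRelPrime (X 0 ^ a : Pxy K) (X 1 ^ b) := by
    refine IsRelPrime.pow ?_
    refine ((X_prime (R := K) (i := (0 : Fin 2))).irreducible.isRelPrime_iff_not_dvd).2 ?_
    simp [X_dvd_X]
  have h := (dvd_gcd h0 h1).trans (gcd_mul_left' f _ _).dvd
  exact h.trans ((associated_mul_unit_left f _ (gcd_isUnit_iff_isRelPrime.2 hrel)).dvd)

lemma exists_eq_truncIdeal {n k l : ℕ} (hn : 3 ≤ n) (hk : 1 ≤ k) (hl : 2 ≤ l)
    {I : Ideal (Pxy K)} (hI : IsHomog I)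
    (ht : ∀ j, hilb K I j = if j < n then j + 1 else if j ≤ n + k then 3
        else if j ≤ n + k + l then 2 else 0) :
    ∃ g h : Pxy K, g.IsHomogeneous 2 ∧ h.IsHomogeneous 1 ∧ g ≠ 0 ∧ h ≠ 0 ∧
      I = truncIdeal n (n + k + 1) (n + k + l + 1) (g * h) g := by
  have hdim (j : ℕ) := hilb_add_finrank_degreePart I j
  have hlow {j : ℕ} (hj : j < n) : Module.finrank K (degreePart I j) = 0 := by
    have := hdim j
    rw [ht, if_pos hj] at this
    omega
  have hthree {j : ℕ} (hj : n ≤ j) (hj' : j ≤ n + k) :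
      Module.finrank K (degreePart I j) + 3 = j + 1 := by
    have := hdim j
    rw [ht, if_neg (by omega), if_pos hj'] at this
    omega
  have htwo {j : ℕ} (hj : n + k + 1 ≤ j) (hj' : j ≤ n + k + l) :
      Module.finrank K (degreePart I j) + 2 = j + 1 := by
    have := hdim j
    rw [ht, if_neg (by omega), if_neg (by omega), if_pos hj'] at this
    omega
  have htop {j : ℕ} (hj : n + k + l + 1 ≤ j) : Module.finrank K (degreePart I j) = j + 1 := by
    have := hdim j
    rw [ht, if_neg (by omega), if_neg (by omega), if_neg (by omega)] at this
    omega
  obtain ⟨a, rfl⟩ := Nat.exists_eq_add_of_le hn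
  obtain ⟨f, hf, hf0, hfV⟩ := exists_degreePart_eq (I := I) (c := 3) (d := a)
    (by have := hthree (j := 3 + a) (by omega) (by omega); omega)
    (by have := hthree (j := 3 + a + 1) (by omega) (by omega); omega)
  obtain ⟨g, hg, hg0, hgV⟩ := exists_degreePart_eq (I := I) (c := 2) (d := a + k + 2)
    (by have := htwo (j := 2 + (a + k + 2)) (by omega) (by omega); omega)
    (by have := htwo (j := 2 + (a + k + 2) + 1) (by omega) (by omega); omega)
  have hfI {j : ℕ} (hj : 3 + a ≤ j) (hj' : j ≤ 3 + a + k) {s : Pxy K} (hs : s.IsHomogeneous j) :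
      s ∈ I ↔ f ∣ s := mem_iff_dvd hf hf0 hfV hj (hthree hj hj') hs
  have hgI {j : ℕ} (hj : 3 + a + k + 1 ≤ j) (hj' : j ≤ 3 + a + k + l) {s : Pxy K}
      (hs : s.IsHomogeneous j) : s ∈ I ↔ g ∣ s :=
    mem_iff_dvd hg hg0 hgV (by omega) (htwo hj hj') hs
  have hIlow {j : ℕ} (hj : j < 3 + a) {s : Pxy K} (hs : s.IsHomogeneous j) (hsI : s ∈ I) :
      s = 0 := by
    have h := Submodule.finrank_eq_zero.1 (hlow hj)
    exact (Submodule.mem_bot K).1 (h.le ⟨hs, hsI⟩)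
  have hItop {j : ℕ} (hj : 3 + a + k + l + 1 ≤ j) {s : Pxy K} (hs : s.IsHomogeneous j) :
      s ∈ I := by
    have h : degreePart I j = homogeneousSubmodule (Fin 2) K j :=
      Submodule.eq_of_le_of_finrank_eq inf_le_left (by rw [htop hj, finrank_homogeneousSubmodule])
    exact (h.ge hs).2
  have hgf : g ∣ f := by
    have hpow (i : Fin 2) : g ∣ f * X i ^ (a + k + 1) := by
      have hX : (X i ^ (a + k + 1) : Pxy K).IsHomogeneous (a + k + 1) :=
        isHomogeneous_X_pow i _
      refine (hgI (j := 3 + (a + k + 1)) (by omega) (by omega) (hf.mul hX)).1 ?_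
      have hXa : (f * X i ^ a : Pxy K) ∈ I :=
        (hfI le_rfl (by omega) (hf.mul (isHomogeneous_X_pow i a))).2 (dvd_mul_right _ _)
      rw [show a + k + 1 = a + (k + 1) from rfl, pow_add, ← mul_assoc]
      exact I.mul_mem_right _ hXa
    exact dvd_of_dvd_mul_X_pow (hpow 0) (hpow 1)
  obtain ⟨h, rfl⟩ := hgf
  refine ⟨g, h, hg, isHomogeneous_of_mul_left hg hg0 hf, hg0, right_ne_zero_of_mul hf0,
    le_antisymm ?_ ?_⟩
  · intro s hs
    rw [← sum_homogeneousComponent s]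
    refine Ideal.sum_mem _ fun j _ => ?_
    have hj := hI s hs j
    have hhom : (homogeneousComponent j s).IsHomogeneous j := homogeneousComponent_isHomogeneous j s
    by_cases h1 : j < 3 + a
    · rw [hIlow h1 hhom hj]
      exact zero_mem _
    · refine Ideal.subset_span ⟨j, hhom, ?_⟩
      by_cases h2 : j ≤ 3 + a + k
      · exact .inl ⟨by omega, (hfI (by omega) h2 hhom).1 hj⟩
      · by_cases h3 : j ≤ 3 + a + k + l
        · exact .inr (.inl ⟨by omega, (hgI (by omega) h3 hhom).1 hj⟩)
        · exact .inr (.inr (by omega))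
  · rw [truncIdeal, Ideal.span_le]
    rintro s ⟨j, hs, hd⟩
    by_cases h3 : 3 + a + k + l + 1 ≤ j
    · exact hItop h3 hs
    · rcases hd with ⟨hj, hd⟩ | ⟨hj, hd⟩ | hj
      · by_cases h2 : j ≤ 3 + a + k
        · exact (hfI hj h2 hs).2 hd
        · exact (hgI (by omega) (by omega) hs).2 (dvd_of_mul_right_dvd hd)
      · exact (hgI hj (by omega) hs).2 hd
      · exact absurd hj h3

lemma exists_eq_C {q : Pxy K} (hq : q.IsHomogeneous 0) : ∃ a : K, q = C a := by
  have hq' := (mem_homogeneousSubmodule 0 q).2 hq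
  rw [homogeneousSubmodule_zero] at hq'
  obtain ⟨a, rfl⟩ := Submodule.mem_one.1 hq'
  exact ⟨a, rfl⟩

/-- The linear form `a x + b y`. -/
def linearForm (a b : K) : Pxy K := C a * X 0 + C b * X 1

lemma isHomogeneous_linearForm (a b : K) : (linearForm a b).IsHomogeneous 1 :=
  (isHomogeneous_C_mul_X a 0).add (isHomogeneous_C_mul_X b 1)

lemma exists_eq_linearForm {h : Pxy K} (hh : h.IsHomogeneous 1) :
    ∃ a b : K, h = linearForm a b := by
  obtain ⟨q, r, hq, hr, rfl⟩ := exists_eq_X_mul_add_X_mul hh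
  obtain ⟨a, rfl⟩ := exists_eq_C hq
  obtain ⟨b, rfl⟩ := exists_eq_C hr
  exact ⟨a, b, by rw [linearForm]; ring⟩

lemma exists_eq_mul_of_isHomogeneous_two [IsAlgClosed K] [NeZero (2 : K)] {g : Pxy K}
    (hg : g.IsHomogeneous 2) :
    ∃ u v : Pxy K, u.IsHomogeneous 1 ∧ v.IsHomogeneous 1 ∧ g = u * v := by
  obtain ⟨q, r, hq, hr, rfl⟩ := exists_eq_X_mul_add_X_mul hg
  obtain ⟨a, b', rfl⟩ := exists_eq_linearForm hq
  obtain ⟨b'', c, rfl⟩ := exists_eq_linearForm hr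
  by_cases ha : a = 0
  · refine ⟨X 1, linearForm (b' + b'') c, isHomogeneous_X K 1, isHomogeneous_linearForm _ _, ?_⟩
    simp only [linearForm, ha, map_add, map_zero]
    ring
  · obtain ⟨s, hs⟩ := IsAlgClosed.exists_eq_mul_self (discrim a (b' + b'') c)
    have hroot := (quadratic_eq_zero_iff ha hs ((-(b' + b'') + s) / (2 * a))).2 (.inl rfl)
    set z := (-(b' + b'') + s) / (2 * a)
    refine ⟨linearForm 1 (-z), linearForm a (b' + b'' + a * z), isHomogeneous_linearForm _ _,
      isHomogeneous_linearForm _ _, ?_⟩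
    have hC := congrArg (C (σ := Fin 2)) hroot
    simp only [map_add, map_mul, map_zero] at hC
    simp only [linearForm, map_add, map_mul, map_neg, map_one]
    linear_combination (X 1) ^ 2 * hC

lemma exists_linChange {a b c d : K} (hD : a * d - b * c ≠ 0) :
    ∃ φ : Pxy K ≃ₐ[K] Pxy K, IsLinChange φ ∧ IsLinChange φ.symm ∧
      φ (linearForm a b) = X 0 ∧ φ (linearForm c d) = X 1 := by
  obtain ⟨e, he⟩ : ∃ e, (a * d - b * c) * e = 1 := ⟨_, mul_inv_cancel₀ hD⟩
  let F : Pxy K →ₐ[K] Pxy K := aeval ![linearForm (d * e) (-b * e), linearForm (-c * e) (a * e)]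
  let G : Pxy K →ₐ[K] Pxy K := aeval ![linearForm a b, linearForm c d]
  have hF (u v : K) : F (linearForm u v) =
      linearForm (u * (d * e) + v * (-c * e)) (u * (-b * e) + v * (a * e)) := by
    simp only [linearForm, F, map_add, map_mul, algHom_C, algebraMap_eq, aeval_X,
      Matrix.cons_val_zero, Matrix.cons_val_one]
    ring
  have hG (u v : K) : G (linearForm u v) = linearForm (u * a + v * c) (u * b + v * d) := by
    simp only [linearForm, G, map_add, map_mul, algHom_C, algebraMap_eq, aeval_X,
      Matrix.cons_val_zero, Matrix.cons_val_one]
    ring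
  have hX0 : linearForm (1 : K) 0 = X 0 := by simp [linearForm]
  have hX1 : linearForm (0 : K) 1 = X 1 := by simp [linearForm]
  have hFX (i : Fin 2) : F (X i) =
      (![linearForm (d * e) (-b * e), linearForm (-c * e) (a * e)] : Fin 2 → Pxy K) i := aeval_X _ _
  have hGX (i : Fin 2) : G (X i) = (![linearForm a b, linearForm c d] : Fin 2 → Pxy K) i :=
    aeval_X _ _
  have hF0 : F (linearForm a b) = X 0 := by
    rw [hF, ← hX0]
    congr 1
    · linear_combination he
    · ring
  have hF1 : F (linearForm c d) = X 1 := by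
    rw [hF, ← hX1]
    congr 1
    · ring
    · linear_combination he
  have hG0 : G (linearForm (d * e) (-b * e)) = X 0 := by
    rw [hG, ← hX0]
    congr 1
    · linear_combination he
    · ring
  have hG1 : G (linearForm (-c * e) (a * e)) = X 1 := by
    rw [hG, ← hX1]
    congr 1
    · ring
    · linear_combination he
  refine ⟨AlgEquiv.ofAlgHom F G ?_ ?_, fun i => ?_, fun i => ?_, hF0, hF1⟩
  · ext i : 1
    rw [AlgHom.comp_apply, hGX]
    fin_cases i
    exacts [hF0, hF1]
  · ext i : 1
    rw [AlgHom.comp_apply, hFX]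
    fin_cases i
    exacts [hG0, hG1]
  · change (F (X i)).IsHomogeneous 1
    rw [hFX]
    fin_cases i <;> exact isHomogeneous_linearForm _ _
  · change (G (X i)).IsHomogeneous 1
    rw [hGX]
    fin_cases i <;> exact isHomogeneous_linearForm _ _

lemma associated_C_mul {a : K} (ha : a ≠ 0) (f : Pxy K) : Associated (C a * f) f :=
  associated_unit_mul_left f _ ((isUnit_iff_ne_zero.2 ha).map C)

lemma associated_or_exists_linChange {u v : Pxy K} (hu : u.IsHomogeneous 1)
    (hv : v.IsHomogeneous 1) (hu0 : u ≠ 0) (hv0 : v ≠ 0) :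
    Associated u v ∨ ∃ φ : Pxy K ≃ₐ[K] Pxy K, IsLinChange φ ∧ IsLinChange φ.symm ∧
      φ u = X 0 ∧ φ v = X 1 := by
  obtain ⟨a, b, rfl⟩ := exists_eq_linearForm hu
  obtain ⟨c, d, rfl⟩ := exists_eq_linearForm hv
  by_cases hD : a * d - b * c = 0
  · left
    have hC := congrArg (C (σ := Fin 2)) hD
    simp only [map_sub, map_mul, map_zero] at hC
    have hca : C c * linearForm a b = C a * linearForm c d := by
      simp only [linearForm]
      linear_combination -(X 1) * hC
    have hdb : C d * linearForm a b = C b * linearForm c d := by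
      simp only [linearForm]
      linear_combination (X 0) * hC
    have key {s t : K} (ht : t ≠ 0) (h : C s * linearForm a b = C t * linearForm c d) :
        Associated (linearForm a b) (linearForm c d) := by
      have hs : s ≠ 0 := by
        rintro rfl
        rw [map_zero, zero_mul] at h
        exact mul_ne_zero (by simpa using ht) hv0 h.symm
      exact (associated_C_mul hs _).symm.trans (h ▸ associated_C_mul ht _)
    by_cases ha : a = 0
    · refine key (fun hb => hu0 ?_) hdb
      simp [linearForm, ha, hb]
    · exact key ha hca
  · exact .inr (exists_linChange hD)

lemma not_associated_X_X : ¬ Associated (X 0 : Pxy K) (X 1) := fun h => by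
  have := h.dvd
  simp [X_dvd_X] at this

lemma exists_linChange_eq_X {u : Pxy K} (hu : u.IsHomogeneous 1) (hu0 : u ≠ 0) :
    ∃ φ : Pxy K ≃ₐ[K] Pxy K, IsLinChange φ ∧ IsLinChange φ.symm ∧ φ u = X 0 := by
  rcases associated_or_exists_linChange hu (isHomogeneous_X K 0) hu0 (X_ne_zero 0) with
    h0 | ⟨φ, hφ, hφ', h, -⟩
  · rcases associated_or_exists_linChange hu (isHomogeneous_X K 1) hu0 (X_ne_zero 1) with
      h1 | ⟨φ, hφ, hφ', h, -⟩
    · exact absurd (h0.symm.trans h1) not_associated_X_X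
    · exact ⟨φ, hφ, hφ', h⟩
  · exact ⟨φ, hφ, hφ', h⟩

/-- Representatives of the pairs of a binary quadratic form and a linear form, up to linear changes
of variables and scalars. -/
def normalForms (K : Type*) [Field K] : Set (Pxy K × Pxy K) :=
  {(X 0 * X 0, X 0), (X 0 * X 0, X 1), (X 0 * X 1, X 0), (X 0 * X 1, X 1), (X 0 * X 1, X 0 + X 1)}

lemma exists_linChange_normalForms [IsAlgClosed K] [NeZero (2 : K)] {g h : Pxy K}
    (hg : g.IsHomogeneous 2) (hh : h.IsHomogeneous 1) (hg0 : g ≠ 0) (hh0 : h ≠ 0) :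
    ∃ φ : Pxy K ≃ₐ[K] Pxy K, IsLinChange φ ∧ IsLinChange φ.symm ∧
      ∃ P ∈ normalForms K, Associated (φ g) P.1 ∧ Associated (φ h) P.2 := by
  obtain ⟨u, v, hu, hv, rfl⟩ := exists_eq_mul_of_isHomogeneous_two hg
  have hu0 := left_ne_zero_of_mul hg0
  have hv0 := right_ne_zero_of_mul hg0
  rcases associated_or_exists_linChange hu hv hu0 hv0 with huv | ⟨φ, hφ, hφ', hφu, hφv⟩
  · have hsq {φ : Pxy K ≃ₐ[K] Pxy K} (hφu : φ u = X 0) :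
        Associated (φ (u * v)) (X 0 * X 0) := by
      rw [map_mul, hφu]
      exact (Associated.refl _).mul_mul (hφu ▸ huv.symm.map φ)
    rcases associated_or_exists_linChange hu hh hu0 hh0 with huh | ⟨φ, hφ, hφ', hφu, hφh⟩
    · obtain ⟨φ, hφ, hφ', hφu⟩ := exists_linChange_eq_X hu hu0
      exact ⟨φ, hφ, hφ', (X 0 * X 0, X 0), by simp [normalForms], hsq hφu,
        hφu ▸ huh.symm.map φ⟩
    · exact ⟨φ, hφ, hφ', (X 0 * X 0, X 1), by simp [normalForms], hsq hφu,
        by rw [hφh]⟩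
  · obtain ⟨a, b, hab⟩ := exists_eq_linearForm (IsLinChange.isHomogeneous hφ hh)
    have hφg : Associated (φ (u * v)) (X 0 * X 1) := by rw [map_mul, hφu, hφv]
    have hφh0 : φ h ≠ 0 := (map_ne_zero_iff φ φ.injective).2 hh0
    by_cases ha : a = 0
    · have hb : b ≠ 0 := fun hb => hφh0 (by simp [hab, linearForm, ha, hb])
      refine ⟨φ, hφ, hφ', (X 0 * X 1, X 1), by simp [normalForms], hφg, ?_⟩
      simpa [hab, linearForm, ha] using associated_C_mul hb (X 1)
    by_cases hb : b = 0
    · refine ⟨φ, hφ, hφ', (X 0 * X 1, X 0), by simp [normalForms], hφg, ?_⟩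
      simpa [hab, linearForm, hb] using associated_C_mul ha (X 0)
    have hua := associated_C_mul ha u
    have hvb := associated_C_mul hb v
    have hh' : h = C a * u + C b * v := by
      apply φ.injective
      rw [hab, map_add, map_mul, map_mul, hφu, hφv, ← algebraMap_eq, φ.commutes, φ.commutes]
      rfl
    rcases associated_or_exists_linChange (hu.C_mul a) (hv.C_mul b) (hua.ne_zero_iff.2 hu0)
      (hvb.ne_zero_iff.2 hv0) with hassoc | ⟨χ, hχ, hχ', hχu, hχv⟩
    · have := (hua.symm.trans (hassoc.trans hvb)).map φ
      rw [hφu, hφv] at this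
      exact absurd this not_associated_X_X
    · refine ⟨χ, hχ, hχ', (X 0 * X 1, X 0 + X 1), by simp [normalForms], ?_, ?_⟩
      · rw [map_mul]
        exact (hχu ▸ hua.symm.map χ).mul_mul (hχv ▸ hvb.symm.map χ)
      · rw [hh', map_add, hχu, hχv]

end BinaryForms

open BinaryForms

/-- The sequence `T₁₀ = (1, 2, …, n, 3, …, 3, 2, …, 2)` is of homogeneous finite
type. -/
theorem stmt12 (K : Type*) [Field K] [IsAlgClosed K] [CharZero K]
    (n k l : ℕ) (hn : 3 ≤ n) (hk : 1 ≤ k) (hl : 2 ≤ l) :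
    HomogFiniteType K
      (fun j => if j < n then j + 1 else if j ≤ n + k then 3
        else if j ≤ n + k + l then 2 else 0) := by
  let J (P : Pxy K × Pxy K) := truncIdeal n (n + k + 1) (n + k + l + 1) (P.1 * P.2) P.1
  refine ⟨J '' normalForms K, Set.Finite.image _ (by simp [normalForms]), ?_, fun I hI ht => ?_⟩
  · rintro _ ⟨P, -, rfl⟩
    exact isHomog_truncIdeal _ _ _ _ _
  · obtain ⟨g, h, hg, hh, hg0, hh0, rfl⟩ := exists_eq_truncIdeal hn hk hl hI ht
    obtain ⟨φ, hφ, hφ', P, hP, hPg, hPh⟩ := exists_linChange_normalForms hg hh hg0 hh0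
    refine ⟨φ, hφ, P, hP, ?_⟩
    rw [map_truncIdeal _ _ _ hφ hφ', map_mul]
    exact (truncIdeal_congr _ _ _ (hPg.mul_mul hPh) hPg).symm
end
end
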